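/- arXiv:hep-th/0112198 — 2 statements merged into one kernel-verified Lean document; each statement's English description precedes it below -/
import Mathlib

section
/- Let j ∈ ℂ with −1/2 < Re j < 0 and let k ∈ ℝ with k ≠ 0. Then the improper Fourier integral of |x|^{2j} converges and lim_{R→∞} ∫_{−R}^{R} e^{ikx} |x|^{2j} dx = √π · (2/|k|)^{2j+1} · Γ(j + 1/2)/Γ(−j), where |x|^{2j} and (2/|k|)^{2j+1} denote complex powers of positive real bases and Γ is the complex Gamma function. -/
open Complex intervalIntegral

theorem aux_norm_le (w : ℂ) (hw : 0 ≤ w.re) : ‖1 - exp (-w)‖ ≤ 2 := by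
  have h1 : ‖exp (-w)‖ ≤ 1 := by
    rw [Complex.norm_exp]; simpa using hw
  calc _ ≤ ‖(1:ℂ)‖ + ‖exp (-w)‖ := norm_sub_le _ _
    _ ≤ 2 := by rw [norm_one]; linarith

theorem aux_norm_le' (w : ℂ) (hw : 0 ≤ w.re) : ‖1 - exp (-w)‖ ≤ 2 * ‖w‖ := by
  by_cases h : ‖w‖ ≤ 1
  · have := Complex.norm_exp_sub_one_le (x := -w) (by simpa using h)
    rw [norm_sub_rev]; simpa using this
  · have := aux_norm_le w hw
    linarith

noncomputable def auxBound (σ M x : ℝ) : ℝ :=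
  if x ≤ 1 then 2 * M * x ^ (σ - 1) else 2 * x ^ (σ - 2)

theorem auxBound_int (σ M : ℝ) (h0 : 0 < σ) (h1 : σ < 1) :
    MeasureTheory.IntegrableOn (auxBound σ M) (Set.Ioi 0) := by
  rw [← Set.Ioc_union_Ioi_eq_Ioi (zero_le_one (α := ℝ))]
  apply MeasureTheory.IntegrableOn.union
  · have : MeasureTheory.IntegrableOn (fun x : ℝ => 2 * M * x ^ (σ - 1)) (Set.Ioc 0 1) := by
      apply MeasureTheory.Integrable.const_mul
      have := intervalIntegral.intervalIntegrable_rpow' (a := 0) (b := 1) (r := σ - 1) (by linarith)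
      exact (intervalIntegrable_iff_integrableOn_Ioc_of_le zero_le_one).1 this
    refine this.congr_fun (fun x hx => ?_) measurableSet_Ioc
    simp [auxBound, hx.2]
  · have : MeasureTheory.IntegrableOn (fun x : ℝ => 2 * x ^ (σ - 2)) (Set.Ioi 1) := by
      apply MeasureTheory.Integrable.const_mul
      exact integrableOn_Ioi_rpow_of_lt (by linarith) zero_lt_one
    refine this.congr_fun (fun x hx => ?_) measurableSet_Ioi
    simp [auxBound, not_le.2 (Set.mem_Ioi.1 hx)]

noncomputable def auxf (s z : ℂ) (x : ℝ) : ℂ := (1 - exp (-(z * x))) * (x : ℂ) ^ (s - 2)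

theorem auxf_le (s z : ℂ) (M : ℝ) (hz : 0 ≤ z.re) (hM : ‖z‖ ≤ M) (x : ℝ) (hx : 0 < x) :
    ‖auxf s z x‖ ≤ auxBound s.re M x := by
  have hre : 0 ≤ (z * x).re := by simp; positivity
  rw [auxf, auxBound, norm_mul, Complex.norm_cpow_eq_rpow_re_of_pos hx]
  have e : (s - 2).re = s.re - 2 := by simp
  rw [e]
  split_ifs with h
  · have h2 := aux_norm_le' _ hre
    have e2 : x ^ (s.re - 1) = x * x ^ (s.re - 2) := by
      rw [show s.re - 1 = 1 + (s.re - 2) by ring, Real.rpow_add hx, Real.rpow_one]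
    rw [e2, ← mul_assoc]
    gcongr
    refine h2.trans ?_
    rw [norm_mul, Complex.norm_real, Real.norm_of_nonneg hx.le, mul_assoc]
    gcongr
  · gcongr
    exact aux_norm_le _ hre

theorem auxf_cont (s z : ℂ) : ContinuousOn (auxf s z) (Set.Ioi 0) := by
  intro x hx
  apply ContinuousAt.continuousWithinAt
  unfold auxf
  apply ContinuousAt.mul
  · fun_prop
  · exact (Complex.continuousAt_ofReal_cpow_const _ _ (Or.inr (ne_of_gt hx)))

theorem auxf_int (s z : ℂ) (h0 : 0 < s.re) (h1 : s.re < 1) (hz : 0 ≤ z.re) :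
    MeasureTheory.IntegrableOn (auxf s z) (Set.Ioi 0) := by
  refine (auxBound_int s.re ‖z‖ h0 h1).mono' ((auxf_cont s z).aestronglyMeasurable measurableSet_Ioi) ?_
  refine (MeasureTheory.ae_restrict_mem measurableSet_Ioi).mono fun x hx => ?_
  exact auxf_le s z _ hz le_rfl x hx

noncomputable def auxF (s z : ℂ) : ℂ := ∫ x in Set.Ioi (0:ℝ), auxf s z x

theorem auxF_cont (s z : ℂ) (h0 : 0 < s.re) (h1 : s.re < 1) :
    ContinuousWithinAt (auxF s) {w | 0 ≤ w.re} z := by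
  unfold auxF
  have hev : ∀ᶠ w in nhdsWithin z {w : ℂ | 0 ≤ w.re}, ‖w‖ ≤ ‖z‖ + 1 := by
    apply nhdsWithin_le_nhds
    have : Filter.Tendsto (fun w : ℂ => ‖w‖) (nhds z) (nhds ‖z‖) := continuous_norm.tendsto z
    exact (this.eventually (gt_mem_nhds (by linarith : ‖z‖ < ‖z‖ + 1))).mono fun w hw => hw.le
  refine MeasureTheory.continuousWithinAt_of_dominated (bound := auxBound s.re (‖z‖ + 1)) ?_ ?_
    (auxBound_int _ _ h0 h1) ?_
  · exact Filter.Eventually.of_forall fun w => (auxf_cont s w).aestronglyMeasurable measurableSet_Ioi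
  · filter_upwards [hev, self_mem_nhdsWithin] with w hw hw2
    refine (MeasureTheory.ae_restrict_mem measurableSet_Ioi).mono fun x hx => ?_
    exact auxf_le s w _ hw2 hw x hx
  · refine Filter.Eventually.of_forall fun x => ?_
    unfold auxf
    fun_prop

noncomputable def auxg (s z : ℂ) (x : ℝ) : ℂ := exp (-(z * x)) * (x : ℂ) ^ (s - 1)

theorem auxg_ii (s z : ℂ) (h0 : 0 < s.re) (R : ℝ) :
    IntervalIntegrable (auxg s z) MeasureTheory.volume 0 R := by
  unfold auxg
  apply IntervalIntegrable.continuousOn_mul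
  · exact intervalIntegral.intervalIntegrable_cpow' (by simpa using h0)
  · fun_prop

theorem aux_parts (s z : ℂ) (h0 : 0 < s.re) (h1 : s.re < 1) (hz : 0 ≤ z.re) (R : ℝ) (hR : 0 < R) :
    z * (∫ x in (0:ℝ)..R, auxg s z x) + (s - 1) * (∫ x in (0:ℝ)..R, auxf s z x) =
      (1 - exp (-(z * R))) * (R : ℂ) ^ (s - 1) := by
  have hf : IntervalIntegrable (auxf s z) MeasureTheory.volume 0 R :=
    (intervalIntegrable_iff_integrableOn_Ioc_of_le hR.le).2
      ((auxf_int s z h0 h1 hz).mono_set Set.Ioc_subset_Ioi_self)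
  have hd : ∀ x : ℝ, 0 < x → HasDerivAt (fun x : ℝ => (1 - exp (-(z * x))) * (x : ℂ) ^ (s - 1))
      (z * auxg s z x + (s - 1) * auxf s z x) x := by
    intro x hx
    have a1 : HasDerivAt (fun x : ℝ => (x : ℂ) ^ (s - 1)) ((s - 1) * (x : ℂ) ^ (s - 1 - 1)) x := by
      have := (hasDerivAt_id (x : ℂ)).cpow_const (c := s - 1) (Or.inl (by simpa using hx))
      simpa using this.comp_ofReal
    have a2 : HasDerivAt (fun x : ℝ => 1 - exp (-(z * x))) (z * exp (-(z * x))) x := by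
      have := ((((hasDerivAt_id (x : ℂ)).const_mul z).neg).cexp).const_sub 1
      have := this.comp_ofReal
      simpa [mul_comm] using this
    refine (a2.mul a1).congr_deriv ?_
    simp only [auxg, auxf, show s - 1 - 1 = s - 2 by ring]
    ring
  have key := intervalIntegral.integral_eq_sub_of_hasDerivAt_of_tendsto hR
    (f := fun x : ℝ => (1 - exp (-(z * x))) * (x : ℂ) ^ (s - 1)) (fa := 0)
    (fb := (1 - exp (-(z * R))) * (R : ℂ) ^ (s - 1))
    (fun x hx => hd x hx.1) (((auxg_ii s z h0 R).const_mul z).add (hf.const_mul (s - 1))) ?_ ?_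
  · rw [intervalIntegral.integral_add ((auxg_ii s z h0 R).const_mul z) (hf.const_mul (s - 1)),
      intervalIntegral.integral_const_mul, intervalIntegral.integral_const_mul] at key
    rw [key, sub_zero]
  · apply squeeze_zero_norm' (a := fun x : ℝ => 2 * ‖z‖ * x ^ s.re)
    · filter_upwards [self_mem_nhdsWithin] with x hx
      have hx : 0 < x := hx
      have hre : 0 ≤ (z * x).re := by simp; positivity
      rw [norm_mul, Complex.norm_cpow_eq_rpow_re_of_pos hx]
      have e : s.re = 1 + (s - 1).re := by simp
      rw [e, Real.rpow_add hx, Real.rpow_one, ← mul_assoc]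
      gcongr
      refine (aux_norm_le' _ hre).trans ?_
      rw [norm_mul, Complex.norm_real, Real.norm_of_nonneg hx.le, mul_assoc]
    · have : Filter.Tendsto (fun x : ℝ => 2 * ‖z‖ * x ^ s.re) (nhds 0) (nhds (2 * ‖z‖ * 0 ^ s.re)) :=
        ((Real.continuousAt_rpow_const _ _ (Or.inr h0.le)).tendsto).const_mul _
      rw [Real.zero_rpow h0.ne', mul_zero] at this
      exact this.mono_left nhdsWithin_le_nhds
  · exact (hd R hR).continuousAt.tendsto.mono_left nhdsWithin_le_nhds

theorem aux_tendsto (s z : ℂ) (h0 : 0 < s.re) (h1 : s.re < 1) (hz : 0 ≤ z.re) (hz0 : z ≠ 0) :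
    Filter.Tendsto (fun R : ℝ => ∫ x in (0:ℝ)..R, auxg s z x) Filter.atTop
      (nhds ((1 - s) / z * auxF s z)) := by
  have t1 := MeasureTheory.intervalIntegral_tendsto_integral_Ioi 0 (auxf_int s z h0 h1 hz) Filter.tendsto_id
  have t2 : Filter.Tendsto (fun R : ℝ => (1 - exp (-(z * R))) * (R : ℂ) ^ (s - 1)) Filter.atTop
      (nhds 0) := by
    apply squeeze_zero_norm' (a := fun x : ℝ => 2 * x ^ (-(1 - s.re)))
    · filter_upwards [Filter.eventually_gt_atTop 0] with x hx
      have hre : 0 ≤ (z * x).re := by simp; positivity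
      rw [norm_mul, Complex.norm_cpow_eq_rpow_re_of_pos hx]
      have e : (s - 1).re = -(1 - s.re) := by simp
      rw [e]
      gcongr
      exact aux_norm_le _ hre
    · simpa using (tendsto_rpow_neg_atTop (y := 1 - s.re) (by linarith)).const_mul 2
  have t3 := (t2.sub (t1.const_mul (s - 1))).div_const z
  have e : (1 - s) / z * auxF s z = (0 - (s - 1) * ∫ x in Set.Ioi (0:ℝ), auxf s z x) / z := by
    rw [auxF]; ring
  rw [e]
  refine t3.congr' ?_
  · filter_upwards [Filter.eventually_gt_atTop 0] with R hR
    rw [← aux_parts s z h0 h1 hz R hR]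
    simp only [id]
    field_simp
    ring

theorem auxg_int (s z : ℂ) (h0 : 0 < s.re) (hz : 0 < z.re) :
    MeasureTheory.IntegrableOn (auxg s z) (Set.Ioi 0) := by
  have hb := integrableOn_rpow_mul_exp_neg_mul_rpow (p := 1) (s := s.re - 1) (b := z.re)
    (by linarith) one_pos hz
  refine hb.mono' ?_ ?_
  · refine ContinuousOn.aestronglyMeasurable ?_ measurableSet_Ioi
    intro x hx
    apply ContinuousAt.continuousWithinAt
    unfold auxg
    apply ContinuousAt.mul
    · fun_prop
    · exact (Complex.continuousAt_ofReal_cpow_const _ _ (Or.inr (ne_of_gt hx)))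
  · refine (MeasureTheory.ae_restrict_mem measurableSet_Ioi).mono fun x hx => ?_
    rw [auxg, norm_mul, Complex.norm_cpow_eq_rpow_re_of_pos hx, Complex.norm_exp, mul_comm]
    simp

theorem auxG_diff (s : ℂ) (h0 : 0 < s.re) :
    DifferentiableOn ℂ (fun z => ∫ x in Set.Ioi (0:ℝ), auxg s z x) {z | 0 < z.re} := by
  intro z hz
  have hz : 0 < z.re := hz
  apply DifferentiableAt.differentiableWithinAt
  have hb := integrableOn_rpow_mul_exp_neg_mul_rpow (p := 1) (s := s.re) (b := z.re / 2)
    (by linarith) one_pos (by linarith)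
  have hopen : {w : ℂ | z.re / 2 < w.re} ∈ nhds z :=
    (isOpen_lt continuous_const Complex.continuous_re).mem_nhds (by simp; linarith)
  refine (hasDerivAt_integral_of_dominated_loc_of_deriv_le (F := fun z x => auxg s z x)
    (F' := fun w x => -(x : ℂ) * auxg s w x) hopen ?_ (auxg_int s z h0 hz) ?_ ?_ hb ?_).2.differentiableAt
  · filter_upwards [hopen] with w hw
    exact (auxg_int s w h0 (by have hw : z.re / 2 < w.re := hw; linarith)).aestronglyMeasurable
  · refine MeasureTheory.AEStronglyMeasurable.mul ?_ (auxg_int s z h0 hz).aestronglyMeasurable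
    exact (by fun_prop : Continuous fun x : ℝ => -(x : ℂ)).aestronglyMeasurable
  · refine (MeasureTheory.ae_restrict_mem measurableSet_Ioi).mono fun x hx w hw => ?_
    have hx : 0 < x := hx
    have hw : z.re / 2 < w.re := hw
    rw [auxg, norm_mul, norm_mul, Complex.norm_cpow_eq_rpow_re_of_pos hx, Complex.norm_exp, norm_neg,
      Complex.norm_real, Real.norm_of_nonneg hx.le]
    have e : s.re = 1 + (s - 1).re := by simp
    rw [e, Real.rpow_add hx, Real.rpow_one]
    rw [mul_comm (Real.exp _), ← mul_assoc]
    simp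
    gcongr
  · refine Filter.Eventually.of_forall fun x w hw => ?_
    have := ((((hasDerivAt_id w).mul_const (x:ℂ)).neg).cexp).mul_const ((x:ℂ) ^ (s - 1))
    refine this.congr_deriv ?_
    simp only [auxg, id, Pi.neg_apply]
    ring

theorem auxG_eq (s z : ℂ) (h0 : 0 < s.re) (hz : 0 < z.re) :
    ∫ x in Set.Ioi (0:ℝ), auxg s z x = Gamma s * z ^ (-s) := by
  have hopen : IsOpen {w : ℂ | 0 < w.re} := isOpen_lt continuous_const Complex.continuous_re
  have hconv : Convex ℝ {w : ℂ | 0 < w.re} := convex_halfSpace_re_gt 0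
  have A1 := (auxG_diff s h0).analyticOnNhd hopen
  have A2 : AnalyticOnNhd ℂ (fun z : ℂ => Gamma s * z ^ (-s)) {w : ℂ | 0 < w.re} := by
    apply DifferentiableOn.analyticOnNhd _ hopen
    intro w hw
    exact ((differentiableAt_id.cpow_const (Or.inl hw)).const_mul _).differentiableWithinAt
  refine A1.eqOn_of_preconnected_of_frequently_eq A2 hconv.isPreconnected (z₀ := 1) (by simp) ?_ hz
  have ht : Filter.Tendsto (fun r : ℝ => (r : ℂ)) (nhdsWithin 1 (Set.Ioi 1)) (nhdsWithin 1 {1}ᶜ) := by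
    apply tendsto_nhdsWithin_of_tendsto_nhds_of_eventually_within
    · have : Filter.Tendsto (fun r : ℝ => (r : ℂ)) (nhds 1) (nhds ((1:ℝ):ℂ)) :=
        Complex.continuous_ofReal.tendsto 1
      rw [Complex.ofReal_one] at this
      exact this.mono_left nhdsWithin_le_nhds
    · filter_upwards [self_mem_nhdsWithin] with r hr
      have : (r:ℝ) ≠ 1 := ne_of_gt hr
      simpa using this
  refine ht.frequently (Filter.Eventually.frequently ?_)
  filter_upwards [self_mem_nhdsWithin] with r hr
  have hr : 0 < r := lt_trans one_pos hr
  have := Complex.integral_cpow_mul_exp_neg_mul_Ioi h0 hr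
  simp only [auxg]
  simp_rw [mul_comm (exp _)]
  rw [this, mul_comm, one_div, ← Complex.ofReal_inv, Complex.ofReal_inv, Complex.inv_cpow, cpow_neg]
  rw [Complex.arg_ofReal_of_nonneg hr.le]
  exact Real.pi_pos.ne

theorem auxF_eq (s z : ℂ) (h0 : 0 < s.re) (h1 : s.re < 1) (hz : 0 ≤ z.re) (hz0 : z ∈ slitPlane) :
    (1 - s) / z * auxF s z = Gamma s * z ^ (-s) := by
  have hz1 : z ≠ 0 := slitPlane_ne_zero hz0
  have pos : ∀ w : ℂ, 0 < w.re → (1 - s) / w * auxF s w = Gamma s * w ^ (-s) := by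
    intro w hw
    have hw0 : w ≠ 0 := by rintro rfl; simp at hw
    rw [← auxG_eq s w h0 hw]
    exact tendsto_nhds_unique (aux_tendsto s w h0 h1 hw.le hw0)
      (MeasureTheory.intervalIntegral_tendsto_integral_Ioi 0 (auxg_int s w h0 hw) Filter.tendsto_id)
  have hp : Filter.Tendsto (fun ε : ℝ => z + ε) (nhdsWithin 0 (Set.Ioi 0))
      (nhdsWithin z {w | 0 ≤ w.re}) := by
    apply tendsto_nhdsWithin_of_tendsto_nhds_of_eventually_within
    · have : Filter.Tendsto (fun ε : ℝ => z + ε) (nhds 0) (nhds (z + (0:ℝ))) :=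
        (by fun_prop : Continuous fun ε : ℝ => z + ε).tendsto 0
      rw [Complex.ofReal_zero, add_zero] at this
      exact this.mono_left nhdsWithin_le_nhds
    · filter_upwards [self_mem_nhdsWithin] with r hr
      have : 0 < r := hr
      simp; linarith
  have c1 : ContinuousWithinAt (fun w => (1 - s) / w * auxF s w) {w | 0 ≤ w.re} z :=
    (continuousWithinAt_const.div continuousWithinAt_id hz1).mul (auxF_cont s z h0 h1)
  have c2 : ContinuousAt (fun w => Gamma s * w ^ (-s)) z :=
    continuousAt_const.mul (continuousAt_id.cpow continuousAt_const hz0)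
  have l1 := c1.tendsto.comp hp
  have l2 := c2.continuousWithinAt.tendsto.comp hp
  refine tendsto_nhds_unique l1 (l2.congr' ?_)
  filter_upwards [self_mem_nhdsWithin] with r hr
  have : 0 < r := hr
  exact (pos (z + r) (by simp; linarith)).symm

theorem aux_final (j : ℂ) (hj1 : (-1/2 : ℝ) < j.re) (hj2 : j.re < 0) (c : ℝ) (hc : 0 < c) :
    Gamma (2 * j + 1) * (I * c) ^ (-(2 * j + 1)) + Gamma (2 * j + 1) * (-(I * c)) ^ (-(2 * j + 1)) =
    (Real.sqrt Real.pi : ℂ) * ((2 / c : ℝ) : ℂ) ^ (2 * j + 1) *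
        Complex.Gamma (j + 1/2) / Complex.Gamma (-j) := by
  have hc0 : (c : ℂ) ≠ 0 := by exact_mod_cast hc.ne'
  have lI : log (I * c) = Real.log c + Real.pi / 2 * I := by
    rw [mul_comm, Complex.log_ofReal_mul hc I_ne_zero, Complex.log_I]
  have lI' : log (-(I * c)) = Real.log c - Real.pi / 2 * I := by
    rw [show -(I * c) = c * (-I) by ring, Complex.log_ofReal_mul hc (neg_ne_zero.2 I_ne_zero),
      Complex.log_neg_I]
    ring
  have hI : I * (c:ℂ) ≠ 0 := mul_ne_zero I_ne_zero hc0
  have e1 : (I * c) ^ (-(2 * j + 1)) = exp (-(Real.pi * (j + 1/2)) * I) * (c : ℂ) ^ (-(2 * j + 1)) := by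
    rw [cpow_def_of_ne_zero hI, cpow_def_of_ne_zero hc0, lI, ← Complex.exp_add, Complex.ofReal_log hc.le]
    congr 1
    ring
  have e2 : (-(I * c)) ^ (-(2 * j + 1)) = exp ((Real.pi * (j + 1/2)) * I) * (c : ℂ) ^ (-(2 * j + 1)) := by
    rw [cpow_def_of_ne_zero (neg_ne_zero.2 hI), cpow_def_of_ne_zero hc0, lI', ← Complex.exp_add,
      Complex.ofReal_log hc.le]
    congr 1
    ring
  have e3 : ((2 / c : ℝ) : ℂ) ^ (2 * j + 1) = 2 * 2 ^ (2 * j) * (c : ℂ) ^ (-(2 * j + 1)) := by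
    rw [div_eq_mul_inv, Complex.ofReal_mul, Complex.mul_cpow_ofReal_nonneg (by norm_num) (by positivity),
      Complex.ofReal_inv, Complex.inv_cpow, ← cpow_neg, Complex.ofReal_ofNat,
      cpow_add _ _ two_ne_zero, cpow_one]
    · ring
    · rw [Complex.arg_ofReal_of_nonneg hc.le]
      exact Real.pi_pos.ne
  have d := Complex.Gamma_mul_Gamma_add_half (j + 1/2)
  have r := Complex.Gamma_mul_Gamma_one_sub (-j)
  have g1 : Gamma (-j) ≠ 0 := Complex.Gamma_ne_zero_of_re_pos (by simpa using hj2)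
  have g2 : Gamma (j + 1) ≠ 0 := Complex.Gamma_ne_zero_of_re_pos (by simp; linarith)
  have e4 : exp (-(Real.pi * (j + 1/2)) * I) + exp ((Real.pi * (j + 1/2)) * I) =
      2 * sin (Real.pi * -j) := by
    have h1 : sin (Real.pi * -j) = cos (Real.pi * (j + 1/2)) := by
      rw [show (Real.pi : ℂ) * (j + 1/2) = Real.pi / 2 - Real.pi * -j by ring, Complex.cos_pi_div_two_sub]
    rw [h1, Complex.two_cos]
    ring
  have p0 : (Real.pi : ℂ) ≠ 0 := by exact_mod_cast Real.pi_ne_zero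
  have hsq : (Real.sqrt Real.pi : ℂ) * Real.sqrt Real.pi = Real.pi := by
    rw [← Complex.ofReal_mul, Real.mul_self_sqrt Real.pi_pos.le]
  have hs0 : (Real.sqrt Real.pi : ℂ) ≠ 0 := by
    intro h; rw [h, zero_mul] at hsq; exact p0 hsq.symm
  rw [show (1 : ℂ) - -j = j + 1 by ring] at r
  rw [show j + 1/2 + 1/2 = j + 1 by ring, show 2 * (j + 1/2) = 2 * j + 1 by ring,
    show 1 - (2 * j + 1) = -(2 * j) by ring, cpow_neg] at d
  have q0 : (2:ℂ) ^ (2 * j) ≠ 0 := by simp [cpow_eq_zero_iff]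
  have s0 : sin (Real.pi * -j) ≠ 0 := by
    intro h; rw [h, div_zero] at r
    exact mul_ne_zero g1 g2 r
  rw [e1, e2, e3, ← mul_add, ← add_mul, e4]
  generalize (c : ℂ) ^ (-(2 * j + 1)) = C
  rw [eq_div_iff s0] at r
  rw [eq_div_iff g1]
  have d' : Gamma (j + 1/2) * Gamma (j + 1) * 2 ^ (2 * j) = Gamma (2 * j + 1) * Real.sqrt Real.pi := by
    rw [d]; field_simp
  apply mul_right_cancel₀ (mul_ne_zero g2 hs0)
  linear_combination (2 * C * Gamma (2 * j + 1) * (Real.sqrt Real.pi : ℂ)) * r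
    - (2 * C * Real.pi) * d' - (2 * 2 ^ (2*j) * C * Gamma (j + 1/2) * Gamma (j+1)) * hsq

/-- For `-1/2 < Re j < 0` and real `k ≠ 0`, the improper
Fourier integral of `|x|^{2j}` converges with
`lim_{R→∞} ∫_{-R}^{R} e^{ikx} |x|^{2j} dx = √π (2/|k|)^{2j+1} Γ(j+1/2)/Γ(-j)`. -/
theorem stmt_7 (j : ℂ) (hj1 : (-1/2 : ℝ) < j.re) (hj2 : j.re < 0)
    (k : ℝ) (hk : k ≠ 0) :
    Filter.Tendsto
      (fun R : ℝ => ∫ x in (-R)..R,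
        Complex.exp (Complex.I * (k : ℂ) * (x : ℂ)) * ((|x| : ℝ) : ℂ) ^ (2 * j))
      Filter.atTop
      (nhds ((Real.sqrt Real.pi : ℂ) * ((2 / |k| : ℝ) : ℂ) ^ (2 * j + 1) *
        Complex.Gamma (j + 1/2) / Complex.Gamma (-j))) := by
  have h0 : 0 < (2 * j + 1).re := by simp; linarith
  have h1 : (2 * j + 1).re < 1 := by simp; linarith
  have main : ∀ z : ℂ, z.re = 0 → z.im ≠ 0 →
      Filter.Tendsto (fun R : ℝ => ∫ x in (0:ℝ)..R, auxg (2 * j + 1) z x) Filter.atTop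
      (nhds (Gamma (2 * j + 1) * z ^ (-(2 * j + 1)))) := by
    intro z hz hz'
    have hs : z ∈ slitPlane := Or.inr hz'
    rw [← auxF_eq _ z h0 h1 hz.ge hs]
    exact aux_tendsto _ z h0 h1 hz.ge (slitPlane_ne_zero hs)
  have T := (main (I * k) (by simp) (by simpa using hk)).add
    (main (-(I * k)) (by simp) (by simpa using hk))
  have hval : Gamma (2 * j + 1) * (I * k) ^ (-(2 * j + 1)) +
      Gamma (2 * j + 1) * (-(I * k)) ^ (-(2 * j + 1)) =
      (Real.sqrt Real.pi : ℂ) * ((2 / |k| : ℝ) : ℂ) ^ (2 * j + 1) *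
        Complex.Gamma (j + 1/2) / Complex.Gamma (-j) := by
    rw [← aux_final j hj1 hj2 |k| (abs_pos.2 hk)]
    rcases abs_choice k with h | h
    · rw [h]
    · rw [h, Complex.ofReal_neg, mul_neg, neg_neg, add_comm]
  rw [hval] at T
  refine T.congr' ?_
  filter_upwards [Filter.eventually_gt_atTop 0] with R hR
  set f : ℝ → ℂ := fun x => Complex.exp (Complex.I * (k : ℂ) * (x : ℂ)) * ((|x| : ℝ) : ℂ) ^ (2 * j)
    with hf
  have p1 : ∀ x ∈ Set.uIcc 0 R, auxg (2 * j + 1) (-(I * k)) x = f x := by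
    intro x hx
    rw [Set.uIcc_of_le hR.le] at hx
    simp [auxg, hf, abs_of_nonneg hx.1]
  have p2 : ∀ x ∈ Set.uIcc 0 R, auxg (2 * j + 1) (I * k) x = f (-x) := by
    intro x hx
    rw [Set.uIcc_of_le hR.le] at hx
    simp [auxg, hf, abs_of_nonneg hx.1]
  have i1 : IntervalIntegrable f MeasureTheory.volume 0 R :=
    (auxg_ii _ (-(I * k)) h0 R).congr_uIoo (fun x hx => p1 x (Set.Ioo_subset_Icc_self hx))
  have i2 : IntervalIntegrable (fun x => f (-x)) MeasureTheory.volume 0 R :=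
    (auxg_ii _ (I * k) h0 R).congr_uIoo (fun x hx => p2 x (Set.Ioo_subset_Icc_self hx))
  have i3 : IntervalIntegrable f MeasureTheory.volume (-R) 0 := by
    have := ((IntervalIntegrable.iff_comp_neg (f := f) (a := 0) (b := -R)).2 (by simpa using i2))
    exact this.symm
  rw [intervalIntegral.integral_congr p1, intervalIntegral.integral_congr p2,
    ← intervalIntegral.integral_add_adjacent_intervals i3 i1, intervalIntegral.integral_comp_neg]
  simp
end

section
/- For every real μ, the function t ↦ (1/t)(1/t − cos(μt)/sinh t) extends to an integrable function on (0, ∞) and ∫₀^∞ (1/t)(1/t − cos(μt)/sinh t) dt = log(2 cosh(πμ/2)). -/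
open MeasureTheory

open Filter Topology in
lemma sinh_prod (x : ℝ) : Tendsto (fun n : ℕ => Real.pi * x * ∏ j ∈ Finset.range n, (1 + x ^ 2 / ((j : ℝ) + 1) ^ 2))
      atTop (𝓝 (Real.sinh (Real.pi * x))) := by
  have h := (Complex.continuous_im.tendsto _).comp (Complex.tendsto_euler_sin_prod (x * Complex.I))
  have e : (Complex.sin (Real.pi * (x * Complex.I))).im = Real.sinh (Real.pi * x) := by
    rw [← mul_assoc, Complex.sin_mul_I, ← Complex.ofReal_mul, ← Complex.ofReal_sinh]
    simp [-Complex.ofReal_sinh]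
  rw [e] at h
  refine h.congr fun n => ?_
  have : (∏ j ∈ Finset.range n, (1 - (x * Complex.I) ^ 2 / ((j : ℂ) + 1) ^ 2) : ℂ) =
        ((∏ j ∈ Finset.range n, (1 + x ^ 2 / ((j : ℝ) + 1) ^ 2) : ℝ) : ℂ) := by
    push_cast
    refine Finset.prod_congr rfl fun j _ => ?_
    rw [mul_pow, Complex.I_sq]; ring
  rw [Function.comp_apply, this]
  rw [show (Real.pi : ℂ) * (x * Complex.I) * ((∏ j ∈ Finset.range n, (1 + x ^ 2 / ((j : ℝ) + 1) ^ 2) : ℝ) : ℂ) = ((Real.pi * x * (∏ j ∈ Finset.range n, (1 + x ^ 2 / ((j : ℝ) + 1) ^ 2)) : ℝ) : ℂ) * Complex.I by push_cast; ring]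
  rw [Complex.im_ofReal_mul, Complex.I_im, mul_one]

lemma prod_split (x : ℝ) (n : ℕ) : ∏ j ∈ Finset.range (2 * n), (1 + x ^ 2 / ((j : ℝ) + 1) ^ 2) =
    (∏ j ∈ Finset.range n, (1 + (x/2) ^ 2 / ((j : ℝ) + 1) ^ 2)) *
    ∏ j ∈ Finset.range n, (1 + x ^ 2 / (2 * (j : ℝ) + 1) ^ 2) := by
  induction n with
  | zero => simp
  | succ n ih =>
    rw [show 2 * (n + 1) = 2 * n + 1 + 1 by ring, Finset.prod_range_succ, Finset.prod_range_succ,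
      ih, Finset.prod_range_succ, Finset.prod_range_succ]
    push_cast
    have : 1 + x ^ 2 / (2 * (n:ℝ) + 1 + 1) ^ 2 = 1 + (x/2) ^ 2 / ((n : ℝ) + 1) ^ 2 := by
      field_simp; ring
    rw [this]; ring

open Filter Topology in
lemma cosh_prod (x : ℝ) : Tendsto (fun n : ℕ => ∏ j ∈ Finset.range n, (1 + x ^ 2 / (2 * (j : ℝ) + 1) ^ 2))
      atTop (𝓝 (Real.cosh (Real.pi * x / 2))) := by
  rcases eq_or_ne x 0 with rfl | hx
  · simp
  have h1 := (sinh_prod x).comp (tendsto_id.const_mul_atTop' (zero_lt_two (α := ℕ)))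
  have h2 := sinh_prod (x / 2)
  have hs : Real.sinh (Real.pi * (x / 2)) ≠ 0 := by
    rw [Ne, Real.sinh_eq_zero]; have := Real.pi_ne_zero; positivity
  have h3 := (h1.div h2 hs).div_const 2
  have e : Real.sinh (Real.pi * x) / Real.sinh (Real.pi * (x / 2)) / 2 = Real.cosh (Real.pi * x / 2) := by
    rw [show Real.pi * x = 2 * (Real.pi * (x / 2)) by ring, Real.sinh_two_mul]
    field_simp
  rw [e] at h3
  refine h3.congr fun n => ?_
  have hp : ∏ j ∈ Finset.range n, (1 + (x/2) ^ 2 / ((j : ℝ) + 1) ^ 2) ≠ 0 := by positivity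
  have := Real.pi_ne_zero
  simp only [Pi.div_apply, Function.comp_apply, id, prod_split]
  field_simp

lemma int_exp_sin (a m : ℝ) (ha : 0 < a) :
    ∫ t in Set.Ioi (0:ℝ), Real.exp (-a * t) * Real.sin (m * t) = m / (a ^ 2 + m ^ 2) := by
  have h0 : a ^ 2 + m ^ 2 ≠ 0 := by positivity
  have hd : ∀ t ∈ Set.Ici (0:ℝ), HasDerivAt (fun t => - Real.exp (-a * t) * (a * Real.sin (m * t) + m * Real.cos (m * t)) / (a^2+m^2)) (Real.exp (-a * t) * Real.sin (m * t)) t := by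
    intro t _
    have h1 : HasDerivAt (fun t : ℝ => m * t) m t := by simpa using (hasDerivAt_id t).const_mul m
    have h2 : HasDerivAt (fun t : ℝ => -a * t) (-a) t := by simpa using (hasDerivAt_id t).const_mul (-a)
    have := ((h2.exp.neg).mul ((h1.sin.const_mul a).add (h1.cos.const_mul m))).div_const (a^2+m^2)
    convert! this using 1
    simp only [Pi.add_apply, Pi.neg_apply]
    field_simp; ring
  have he : Filter.Tendsto (fun t : ℝ => Real.exp (-a * t)) Filter.atTop (nhds 0) := by
    refine Real.tendsto_exp_atBot.comp ?_
    exact Filter.tendsto_id.const_mul_atTop_of_neg (by linarith)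
  have hi : IntegrableOn (fun t => Real.exp (-a * t) * Real.sin (m * t)) (Set.Ioi 0) := by
    refine Integrable.mono' (exp_neg_integrableOn_Ioi 0 ha) (by fun_prop) (.of_forall fun t => ?_)
    rw [norm_mul, Real.norm_eq_abs, Real.abs_exp, Real.norm_eq_abs]
    exact mul_le_of_le_one_right (Real.exp_pos _).le (Real.abs_sin_le_one _)
  have hl : Filter.Tendsto (fun t => - Real.exp (-a * t) * (a * Real.sin (m * t) + m * Real.cos (m * t)) / (a^2+m^2)) Filter.atTop (nhds 0) := by
    have hz : Filter.Tendsto (fun t => Real.exp (-a * t) * ((|a| + |m|) / (a^2+m^2))) Filter.atTop (nhds 0) := by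
      simpa using he.mul_const ((|a| + |m|) / (a^2+m^2))
    refine squeeze_zero_norm (fun t => ?_) hz
    rw [mul_div_assoc, norm_mul, norm_neg, Real.norm_eq_abs, Real.abs_exp, norm_div, Real.norm_eq_abs, Real.norm_eq_abs, abs_of_nonneg (by positivity : 0 ≤ a^2+m^2)]
    gcongr
    refine (abs_add_le _ _).trans ?_
    rw [abs_mul, abs_mul]
    gcongr
    · exact mul_le_of_le_one_right (abs_nonneg _) (Real.abs_sin_le_one _)
    · exact mul_le_of_le_one_right (abs_nonneg _) (Real.abs_cos_le_one _)
  rw [integral_Ioi_of_hasDerivAt_of_tendsto' hd hi hl]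
  simp; ring

lemma one_sub_cos_bd (u : ℝ) : |1 - Real.cos u| ≤ u ^ 2 / 2 := by
  rw [abs_of_nonneg (by linarith [Real.cos_le_one u])]
  linarith [Real.one_sub_sq_div_two_le_cos (x := u)]

lemma one_sub_cos_bd2 (u : ℝ) : |1 - Real.cos u| ≤ 2 := by
  rw [abs_of_nonneg (by linarith [Real.cos_le_one u])]
  linarith [Real.neg_one_le_cos u]

lemma integrable_crit (f : ℝ → ℝ) (C D : ℝ) (hm : Measurable f) (h1 : ∀ t > 0, |f t| ≤ C) (h2 : ∀ t > 0, |f t| ≤ D / t ^ 2) :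
    IntegrableOn f (Set.Ioi 0) := by
  rw [← Set.Ioc_union_Ioi_eq_Ioi (zero_le_one (α := ℝ))]
  refine IntegrableOn.union ?_ ?_
  · refine Measure.integrableOn_of_bounded (M := C) (by simp) hm.aestronglyMeasurable ?_
    exact (ae_restrict_mem measurableSet_Ioc).mono fun t ht => h1 t ht.1
  · have := (integrableOn_Ioi_rpow_of_lt (show (-2:ℝ) < -1 by norm_num) zero_lt_one).const_mul D
    refine Integrable.mono' this hm.aestronglyMeasurable ?_
    refine (ae_restrict_mem measurableSet_Ioi).mono fun t ht => ?_
    have ht0 : (0:ℝ) < t := zero_lt_one.trans ht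
    refine (h2 t ht0).trans_eq ?_
    rw [Real.rpow_neg ht0.le, Real.rpow_two]; rfl

lemma int_h (m : ℝ) : IntegrableOn (fun t => (1 - Real.cos (m * t)) / (t * Real.sinh t)) (Set.Ioi 0) := by
  have key : ∀ t > (0:ℝ), ∀ B, |1 - Real.cos (m * t)| ≤ B → |(1 - Real.cos (m * t)) / (t * Real.sinh t)| ≤ B / t ^ 2 := by
    intro t ht B hB
    have hs : t ≤ Real.sinh t := Real.self_le_sinh_iff.2 ht.le
    have hB0 := (abs_nonneg _).trans hB
    rw [abs_div, abs_of_pos (a := t * _) (by positivity)]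
    gcongr
    nlinarith
  refine integrable_crit _ (m ^ 2 / 2) 2 (by fun_prop) (fun t ht => ?_) (fun t ht => key t ht _ (one_sub_cos_bd2 _))
  refine (key t ht _ (one_sub_cos_bd _)).trans_eq ?_
  field_simp

lemma int_log (a m : ℝ) (ha : 0 < a) :
    IntegrableOn (fun t => Real.exp (-a * t) * ((1 - Real.cos (m * t)) / t)) (Set.Ioi 0) ∧
    ∫ t in Set.Ioi (0:ℝ), Real.exp (-a * t) * ((1 - Real.cos (m * t)) / t) = Real.log (1 + m ^ 2 / a ^ 2) / 2 := by
  have hi : ∀ m : ℝ, IntegrableOn (fun t => Real.exp (-a * t) * ((1 - Real.cos (m * t)) / t)) (Set.Ioi 0) := by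
    intro m
    have hb := (exp_neg_integrableOn_Ioi 0 ha).mul_const |m|
    refine Integrable.mono' hb (Measurable.aestronglyMeasurable (by fun_prop)) ?_
    refine (ae_restrict_mem measurableSet_Ioi).mono fun t ht => ?_
    have ht : 0 < t := ht
    rw [norm_mul, Real.norm_eq_abs, Real.abs_exp, norm_div, Real.norm_eq_abs, Real.norm_eq_abs, abs_of_pos ht]
    gcongr
    rw [div_le_iff₀ ht]
    rcases le_total (|m| * t) 2 with h | h
    · have := one_sub_cos_bd (m * t)
      rw [← sq_abs, abs_mul, abs_of_pos ht] at this
      nlinarith [show 0 ≤ |m| * t by positivity]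
    · exact (one_sub_cos_bd2 _).trans h
  refine ⟨hi m, ?_⟩
  have hD : ∀ x, HasDerivAt (fun x => ∫ t in Set.Ioi (0:ℝ), Real.exp (-a * t) * ((1 - Real.cos (x * t)) / t)) (x / (a ^ 2 + x ^ 2)) x := by
    intro x
    rw [← int_exp_sin a x ha]
    refine (hasDerivAt_integral_of_dominated_loc_of_deriv_le (F' := fun x t => Real.exp (-a * t) * Real.sin (x * t)) (bound := fun t => Real.exp (-a * t)) (s := Set.univ) Filter.univ_mem (.of_forall fun y => (hi y).1) (hi x) (by fun_prop) (.of_forall fun t y _ => ?_) (exp_neg_integrableOn_Ioi 0 ha) ?_).2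
    · rw [norm_mul, Real.norm_eq_abs, Real.abs_exp, Real.norm_eq_abs]
      exact mul_le_of_le_one_right (Real.exp_pos _).le (Real.abs_sin_le_one _)
    · refine (ae_restrict_mem measurableSet_Ioi).mono fun t ht y _ => ?_
      have ht : 0 < t := ht
      have h1 : HasDerivAt (fun y : ℝ => y * t) t y := by simpa using (hasDerivAt_id y).mul_const t
      convert! ((h1.cos.const_sub 1).div_const t).const_mul (Real.exp (-a * t)) using 1
      field_simp
  have hE : ∀ x, HasDerivAt (fun x => Real.log (1 + x ^ 2 / a ^ 2) / 2) (x / (a ^ 2 + x ^ 2)) x := by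
    intro x
    have h1 : HasDerivAt (fun x : ℝ => 1 + x ^ 2 / a ^ 2) (2 * x / a ^ 2) x := by
      simpa using ((hasDerivAt_pow 2 x).div_const (a^2)).const_add 1
    convert! (h1.log (by positivity)).div_const 2 using 1
    field_simp
  have hc := is_const_of_deriv_eq_zero (f := fun x => (∫ t in Set.Ioi (0:ℝ), Real.exp (-a * t) * ((1 - Real.cos (x * t)) / t)) - Real.log (1 + x ^ 2 / a ^ 2) / 2)
    (fun x => ((hD x).sub (hE x)).differentiableAt) (fun x => by
      have := ((hD x).sub (hE x)).deriv
      rw [sub_self] at this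
      exact this) m 0
  simp at hc
  simp only [neg_mul]
  linarith

lemma geom (t : ℝ) (ht : 0 < t) (n : ℕ) :
    ∑ j ∈ Finset.range n, 2 * Real.exp (-(2 * (j:ℝ) + 1) * t) = (1 - Real.exp (-(2 * n) * t)) / Real.sinh t := by
  have hs : 0 < Real.sinh t := Real.sinh_pos_iff.2 ht
  induction n with
  | zero => simp
  | succ n ih =>
    rw [Finset.sum_range_succ, ih, div_add' _ _ _ hs.ne']
    congr 1
    have e1 : Real.exp (-(2 * (n:ℝ) + 1) * t) * Real.exp t = Real.exp (-(2 * n) * t) := by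
      rw [← Real.exp_add]; congr 1; ring
    have e2 : Real.exp (-(2 * (n:ℝ) + 1) * t) * Real.exp (-t) = Real.exp (-(2 * (n + 1 : ℕ)) * t) := by
      rw [← Real.exp_add]; congr 1; push_cast; ring
    rw [← e1, ← e2, Real.sinh_eq]; ring

open Filter Topology in
lemma val_h (m : ℝ) : ∫ t in Set.Ioi (0:ℝ), (1 - Real.cos (m * t)) / (t * Real.sinh t) = Real.log (Real.cosh (Real.pi * m / 2)) := by
  have hL : Tendsto (fun n : ℕ => ∫ t in Set.Ioi (0:ℝ), ∑ j ∈ Finset.range n, 2 * (Real.exp (-(2 * (j:ℝ) + 1) * t) * ((1 - Real.cos (m * t)) / t))) atTop (𝓝 (∫ t in Set.Ioi (0:ℝ), (1 - Real.cos (m * t)) / (t * Real.sinh t))) := by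
    have eq : ∀ t > (0:ℝ), ∀ n : ℕ, ∑ j ∈ Finset.range n, 2 * (Real.exp (-(2 * (j:ℝ) + 1) * t) * ((1 - Real.cos (m * t)) / t)) = (1 - Real.exp (-(2 * n) * t)) * ((1 - Real.cos (m * t)) / (t * Real.sinh t)) := by
      intro t ht n
      simp_rw [← mul_assoc]
      rw [← Finset.sum_mul, geom t ht n]
      ring
    refine tendsto_integral_of_dominated_convergence (fun t => ‖(1 - Real.cos (m * t)) / (t * Real.sinh t)‖) (fun n => Measurable.aestronglyMeasurable (by fun_prop)) (int_h m).norm ?_ ?_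
    · intro n
      refine (ae_restrict_mem measurableSet_Ioi).mono fun t ht => ?_
      have ht : 0 < t := ht
      rw [eq t ht n, norm_mul]
      refine mul_le_of_le_one_left (norm_nonneg _) ?_
      have : Real.exp (-(2 * n) * t) ≤ 1 := Real.exp_le_one_iff.2 (by
        have : 0 ≤ (n:ℝ) * t := by positivity
        linarith)
      rw [Real.norm_eq_abs, abs_of_nonneg (by linarith)]
      linarith [Real.exp_pos (-(2 * n) * t)]
    · refine (ae_restrict_mem measurableSet_Ioi).mono fun t ht => ?_
      have ht : 0 < t := ht
      simp_rw [eq t ht]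
      have he : Tendsto (fun n : ℕ => Real.exp (-(2 * n) * t)) atTop (𝓝 0) := by
        refine Real.tendsto_exp_atBot.comp ?_
        have := (tendsto_natCast_atTop_atTop (R := ℝ)).const_mul_atTop_of_neg (show -(2 * t) < 0 by linarith)
        refine this.congr fun n => by ring
      simpa using (he.const_sub 1).mul_const ((1 - Real.cos (m * t)) / (t * Real.sinh t))
  refine tendsto_nhds_unique hL ?_
  have := (cosh_prod m).log (Real.cosh_pos _).ne'
  refine this.congr fun n => ?_
  rw [integral_finsetSum, Real.log_prod (fun j _ => by positivity)]
  · refine Finset.sum_congr rfl fun j _ => ?_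
    rw [integral_const_mul, (int_log _ m (by positivity)).2]; ring
  · intro j _
    exact (int_log _ m (by positivity)).1.const_mul 2

lemma sinh_le_mul_cosh (t : ℝ) (ht : 0 ≤ t) : Real.sinh t ≤ t * Real.cosh t := by
  have hm : MonotoneOn (fun t => t * Real.cosh t - Real.sinh t) (Set.Ici 0) := by
    refine monotoneOn_of_deriv_nonneg (convex_Ici 0) (by fun_prop) (by fun_prop) ?_
    intro x hx
    rw [interior_Ici] at hx
    have hx : 0 < x := hx
    have := (((hasDerivAt_id x).mul (Real.hasDerivAt_cosh x)).sub (Real.hasDerivAt_sinh x)).deriv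
    have e : deriv (fun t => t * Real.cosh t - Real.sinh t) x = x * Real.sinh x := by
      convert! this using 1
      simp
    rw [e]
    have := Real.sinh_pos_iff.2 hx
    positivity
  have := hm (Set.mem_Ici.2 le_rfl) (Set.mem_Ici.2 ht) ht
  simp at this
  exact this

lemma int_0 : IntegrableOn (fun t : ℝ => (1 / t) * (1 / t - 1 / Real.sinh t)) (Set.Ioi 0) := by
  have nn : ∀ t > (0:ℝ), 0 ≤ 1 / t - 1 / Real.sinh t := by
    intro t ht
    have := one_div_le_one_div_of_le ht (Real.self_le_sinh_iff.2 ht.le)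
    linarith
  refine integrable_crit _ (1/2) 1 (by fun_prop) (fun t ht => ?_) (fun t ht => ?_)
  · rw [abs_of_nonneg (mul_nonneg (by positivity) (nn t ht))]
    have h1 : Real.sinh t ≤ t * Real.exp (t ^ 2 / 2) :=
      (sinh_le_mul_cosh t ht.le).trans (by gcongr; exact Real.cosh_le_exp_half_sq t)
    have hs : 0 < Real.sinh t := Real.sinh_pos_iff.2 ht
    have h2 := one_div_le_one_div_of_le hs h1
    have h3 : 1 / (t * Real.exp (t ^ 2 / 2)) = Real.exp (-(t ^ 2 / 2)) / t := by
      rw [Real.exp_neg]; field_simp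
    have h4 : (1 - t ^ 2 / 2) / t ≤ Real.exp (-(t ^ 2 / 2)) / t := by
      gcongr; linarith [Real.add_one_le_exp (-(t ^ 2 / 2))]
    have h5 : 1 / t - (1 - t ^ 2 / 2) / t = t / 2 := by field_simp; ring
    calc (1 / t) * (1 / t - 1 / Real.sinh t) ≤ (1 / t) * (t / 2) := by gcongr; linarith
      _ = 1 / 2 := by field_simp
  · rw [abs_of_nonneg (mul_nonneg (by positivity) (nn t ht))]
    have hs : 0 < Real.sinh t := Real.sinh_pos_iff.2 ht
    calc (1 / t) * (1 / t - 1 / Real.sinh t) ≤ (1 / t) * (1 / t) := by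
          gcongr; linarith [one_div_pos.2 hs]
      _ = 1 / t ^ 2 := by field_simp

open Filter Topology in
lemma val_0 : ∫ t in Set.Ioi (0:ℝ), (1 / t) * (1 / t - 1 / Real.sinh t) = Real.log 2 := by
  let g : ℝ → ℝ := fun t => Real.cosh t / Real.sinh t - 1 / t
  have eq : ∀ t > (0:ℝ), t⁻¹ • (g (1 * t) - g (1/2 * t)) = (1 / t) * (1 / t - 1 / Real.sinh t) := by
    intro t ht
    obtain ⟨s, hs, rfl⟩ : ∃ s > 0, t = 2 * s := ⟨t / 2, by positivity, by ring⟩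
    have h := Real.sinh_pos_iff.2 hs
    have hc := Real.cosh_pos s
    simp only [g, smul_eq_mul]
    rw [one_mul, show 1 / 2 * (2 * s) = s by ring, Real.sinh_two_mul, Real.cosh_two_mul, Real.cosh_sq]
    field_simp
    have := Real.cosh_sq s
    ring_nf
    rw [this]; ring
  have hint : IntegrableOn (fun t => t⁻¹ • (g (1 * t) - g (1/2 * t))) (Set.Ioi 0) :=
    int_0.congr_fun (fun t ht => (eq t ht).symm) measurableSet_Ioi
  have hf : LocallyIntegrableOn g (Set.Ioi 0) := by
    refine ContinuousOn.locallyIntegrableOn ?_ measurableSet_Ioi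
    intro t ht
    have ht : 0 < t := ht
    have := Real.sinh_pos_iff.2 ht
    refine ContinuousAt.continuousWithinAt ?_
    exact (Real.continuous_cosh.continuousAt.div Real.continuous_sinh.continuousAt this.ne').sub (continuousAt_const.div continuousAt_id ht.ne')
  have hL : Tendsto g (𝓝[>] 0) (𝓝 0) := by
    have h0 : Tendsto Real.sinh (𝓝[>] 0) (𝓝 0) := by
      have := Real.continuous_sinh.tendsto 0
      rw [Real.sinh_zero] at this
      exact this.mono_left nhdsWithin_le_nhds
    refine squeeze_zero' ?_ ?_ h0
    · filter_upwards [self_mem_nhdsWithin] with t ht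
      have ht : 0 < t := ht
      have hs := Real.sinh_pos_iff.2 ht
      simp only [g]
      rw [sub_nonneg, div_le_div_iff₀ ht hs]
      linarith [sinh_le_mul_cosh t ht.le]
    · filter_upwards [self_mem_nhdsWithin] with t ht
      have ht : 0 < t := ht
      have hs := Real.sinh_pos_iff.2 ht
      have h1 := one_div_le_one_div_of_le ht (Real.self_le_sinh_iff.2 ht.le)
      have h2 : Real.cosh t / Real.sinh t - 1 / Real.sinh t ≤ Real.sinh t := by
        rw [← sub_div, div_le_iff₀ hs]
        nlinarith [Real.cosh_sq t, Real.one_le_cosh t]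
      simp only [g]; linarith
  have hR : Tendsto g atTop (𝓝 1) := by
    have hi : Tendsto (fun t : ℝ => 1 / t) atTop (𝓝 0) := by
      simpa using tendsto_inv_atTop_zero (𝕜 := ℝ)
    have hz : Tendsto (fun t : ℝ => 1 + 1 / t - 1 / t) atTop (𝓝 1) := by simp
    have hz1 : Tendsto (fun t : ℝ => 1 - 1 / t) atTop (𝓝 1) := by simpa using hi.const_sub 1
    refine tendsto_of_tendsto_of_tendsto_of_le_of_le' hz1 hz ?_ ?_
    · filter_upwards [eventually_gt_atTop 0] with t ht
      have hs := Real.sinh_pos_iff.2 ht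
      simp only [g]
      gcongr
      rw [one_le_div hs]; exact (Real.sinh_lt_cosh t).le
    · filter_upwards [eventually_gt_atTop 0] with t ht
      have hs := Real.sinh_pos_iff.2 ht
      simp only [g]
      gcongr
      have h1 := one_div_le_one_div_of_le ht (Real.self_le_sinh_iff.2 ht.le)
      have h2 : Real.cosh t / Real.sinh t ≤ 1 + 1 / Real.sinh t := by
        rw [div_le_iff₀ hs, add_mul, one_div_mul_cancel hs.ne']
        nlinarith [Real.cosh_sq t, Real.one_le_cosh t]
      linarith
  have := Frullani.integral_Ioi_eq hf one_pos (by norm_num : (0:ℝ) < 1/2) hL hR hint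
  rw [← setIntegral_congr_fun measurableSet_Ioi eq, this]
  simp

/-- For every real `μ`, the function
`t ↦ (1/t)(1/t - cos(μt)/sinh t)` is integrable on `(0,∞)` and
`∫₀^∞ (1/t)(1/t - cos(μt)/sinh t) dt = log(2 cosh(πμ/2))`. -/
theorem stmt_10 (μ : ℝ) :
    IntegrableOn (fun t : ℝ => (1 / t) * (1 / t - Real.cos (μ * t) / Real.sinh t))
      (Set.Ioi 0) ∧
    ∫ t in Set.Ioi (0 : ℝ), (1 / t) * (1 / t - Real.cos (μ * t) / Real.sinh t) =
      Real.log (2 * Real.cosh (Real.pi * μ / 2)) := by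
  have e : (fun t : ℝ => (1 / t) * (1 / t - Real.cos (μ * t) / Real.sinh t)) =
      fun t => (1 / t) * (1 / t - 1 / Real.sinh t) + (1 - Real.cos (μ * t)) / (t * Real.sinh t) := by
    funext t
    simp only [div_eq_mul_inv, mul_inv]; ring
  rw [e]
  refine ⟨int_0.add (int_h μ), ?_⟩
  rw [integral_add int_0 (int_h μ), val_0, val_h, Real.log_mul two_ne_zero (Real.cosh_pos _).ne']
end
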